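/- arXiv:2210.13121 — 2 statements merged into one kernel-verified Lean document; each statement's English description precedes it below -/
import Mathlib

section
/- Let 𝒳 be a Polish space, let P be a Borel probability measure on 𝒳, let X_1, X_2, … be i.i.d. with law P, and let L_{X^n} = (1/n)∑_{i=1}^n δ_{X_i}. Then for each b ∈ (0,∞) there is a compact set 𝒦_b ⊆ 𝒫(𝒳) (the space of Borel probability measures with the weak topology) such that liminf_{n→∞} −(1/n) log ℙ{L_{X^n} ∈ 𝒦_b^c} ≥ b; that is, the laws of the empirical measures L_{X^n} form an exponentially tight sequence. -/
open MeasureTheory Filter Topology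
open scoped ENNReal NNReal Classical

/-- `-(1/n) log p`, as an extended real number. -/
noncomputable def negLogRate (n : ℕ) (p : ℝ≥0∞) : EReal :=
  (-(((n : ℝ)⁻¹ : ℝ) : EReal)) * ENNReal.log p

/-- The empirical measure `L_{x^n} = (1/n) ∑ δ_{x_i}` of `x : Fin (n+1) → X`, as a Borel
probability measure (an element of `𝒫(X)` with the weak topology). -/
noncomputable def empDist {X : Type*} [MeasurableSpace X] {n : ℕ} (x : Fin (n + 1) → X) :
    ProbabilityMeasure X :=
  ⟨((n + 1 : ℕ) : ℝ≥0∞)⁻¹ • ∑ i, Measure.dirac (x i), by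
    constructor
    rw [Measure.smul_apply, Measure.finset_sum_apply]
    simp [ENNReal.inv_mul_cancel]⟩

/-- A Borel probability measure on a Polish space admits compact sets `Γ m` and a weight `W ≥ 1`,
at least `R ^ (m + 1)` off `Γ m`, of integral at most `2`. -/
lemma exists_compact_exhaustion_lintegral_weight_le {X : Type*} [MeasurableSpace X]
    [TopologicalSpace X] [PolishSpace X] [BorelSpace X] (P : Measure X) [IsProbabilityMeasure P]
    {R : ℝ≥0∞} (hR : R ≠ ⊤) :
    ∃ (Γ : ℕ → Set X) (W : X → ℝ≥0∞), (∀ m, IsCompact (Γ m)) ∧ Measurable W ∧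
      (∀ x, 1 ≤ W x) ∧ (∀ m, ∀ x ∉ Γ m, R ^ (m + 1) ≤ W x) ∧ ∫⁻ x, W x ∂P ≤ 2 := by
  obtain ⟨δ, hδ, hsum⟩ := ENNReal.exists_pos_sum_of_countable' (one_ne_zero (α := ℝ≥0∞)) ℕ
  have hpowt (m : ℕ) : R ^ (m + 1) ≠ ⊤ := ENNReal.pow_ne_top hR
  have htight (m : ℕ) : ∃ K : Set X, IsCompact K ∧ P Kᶜ ≤ δ m / R ^ (m + 1) := by
    obtain ⟨K, hK, h⟩ := isTightMeasureSet_iff_exists_isCompact_measure_compl_le.1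
      (isTightMeasureSet_singleton (μ := P)) (δ m / R ^ (m + 1))
      (ENNReal.div_pos (hδ m).ne' (hpowt m))
    exact ⟨K, hK, h P rfl⟩
  choose Γ hΓ hPΓ using htight
  have hmeas (m : ℕ) : MeasurableSet (Γ m)ᶜ := (hΓ m).isClosed.measurableSet.compl
  have hind (m : ℕ) : Measurable ((Γ m)ᶜ.indicator fun _ => R ^ (m + 1)) :=
    measurable_const.indicator (hmeas m)
  refine ⟨Γ, fun x => 1 + ∑' m, (Γ m)ᶜ.indicator (fun _ => R ^ (m + 1)) x, hΓ, ?_,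
    fun x => le_self_add, fun m x hx => ?_, ?_⟩
  · exact measurable_const.add (Measurable.tsum hind)
  · calc R ^ (m + 1) = (Γ m)ᶜ.indicator (fun _ => R ^ (m + 1)) x :=
          (Set.indicator_of_mem (s := (Γ m)ᶜ) hx fun _ => R ^ (m + 1)).symm
      _ ≤ ∑' m, (Γ m)ᶜ.indicator (fun _ => R ^ (m + 1)) x :=
          ENNReal.le_tsum (f := fun m => (Γ m)ᶜ.indicator (fun _ => R ^ (m + 1)) x) m
      _ ≤ _ := le_add_self
  · rw [lintegral_add_left measurable_const, lintegral_tsum fun m => (hind m).aemeasurable]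
    simp only [lintegral_const, measure_univ, mul_one]
    calc 1 + ∑' m, ∫⁻ x, (Γ m)ᶜ.indicator (fun _ => R ^ (m + 1)) x ∂P
        ≤ 1 + ∑' m, δ m := by
          gcongr with m
          rw [lintegral_indicator_const (hmeas m), mul_comm]
          exact ENNReal.mul_le_of_le_div (hPΓ m)
      _ ≤ 1 + 1 := by gcongr
      _ = 2 := one_add_one_eq_two

/-- Chernoff bound for a product of i.i.d. nonnegative variables. -/
lemma pow_mul_measure_pi_le_prod_le {X : Type*} [MeasurableSpace X] (P : Measure X)
    [IsProbabilityMeasure P] {W : X → ℝ≥0∞} (hW : Measurable W) (R : ℝ≥0∞) (n : ℕ) :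
    R ^ n * (Measure.pi fun _ : Fin n => P) {x | R ^ n ≤ ∏ i, W (x i)} ≤
      (∫⁻ x, W x ∂P) ^ n := by
  have hcomp (i : Fin n) : Measurable fun x : Fin n → X => W (x i) :=
    hW.comp (measurable_pi_apply i)
  have hprod : ∫⁻ x, ∏ i, W (x i) ∂(Measure.pi fun _ : Fin n => P) = (∫⁻ x, W x ∂P) ^ n := by
    have hindep : ProbabilityTheory.iIndepFun (fun (i : Fin n) (x : Fin n → X) => W (x i))
        (Measure.pi fun _ : Fin n => P) :=
      ProbabilityTheory.iIndepFun_pi (X := fun _ => W) fun _ => hW.aemeasurable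
    rw [ProbabilityTheory.lintegral_prod_eq_prod_lintegral_of_indepFun Finset.univ _ hindep hcomp]
    have (i : Fin n) : ∫⁻ x, W (x i) ∂(Measure.pi fun _ : Fin n => P) = ∫⁻ x, W x ∂P :=
      (measurePreserving_eval (fun _ : Fin n => P) i).lintegral_comp hW
    simp [this]
  rw [← hprod]
  exact mul_meas_ge_le_lintegral (by fun_prop) _

/-- If the product of the weights is below `R ^ (n + 1)`, then the empirical measure gives mass at
most `1 / (m + 1)` to any set on which the weight is at least `R ^ (m + 1)`. -/
lemma empDist_le_of_prod_lt {X : Type*} [MeasurableSpace X] {W : X → ℝ≥0∞} (hW : ∀ x, 1 ≤ W x)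
    {R : ℝ≥0∞} (hR : 1 ≤ R) {n m : ℕ} {x : Fin (n + 1) → X} {A : Set X} (hA : MeasurableSet A)
    (hWA : ∀ y ∈ A, R ^ (m + 1) ≤ W y) (hx : ∏ i, W (x i) < R ^ (n + 1)) :
    empDist x A ≤ 1 / ((m : ℝ≥0) + 1) := by
  set c := (Finset.univ.filter fun i => x i ∈ A).card with hc
  have hlt : R ^ ((m + 1) * c) < R ^ (n + 1) := by
    refine lt_of_le_of_lt ?_ hx
    calc R ^ ((m + 1) * c) = ∏ i, if x i ∈ A then R ^ (m + 1) else 1 := by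
          rw [Finset.prod_ite, Finset.prod_const, Finset.prod_const_one, mul_one, pow_mul]
      _ ≤ ∏ i, W (x i) := by
          gcongr with i
          split_ifs with h
          exacts [hWA _ h, hW _]
  have hcn : (m + 1) * c < n + 1 := by
    by_contra! h
    exact hlt.not_ge (pow_le_pow_right₀ hR h)
  have hval : (empDist x : Measure X) A = ((n + 1 : ℕ) : ℝ≥0∞)⁻¹ * c := by
    simp only [empDist, ProbabilityMeasure.coe_mk, Measure.smul_apply, Measure.finsetSum_apply,
      Measure.dirac_apply' _ hA, smul_eq_mul, Set.indicator_apply, Pi.one_apply, Finset.sum_boole,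
      hc]
  have hval' : empDist x A = ((n + 1 : ℕ) : ℝ≥0)⁻¹ * c := by
    rw [← ENNReal.coe_inj, ProbabilityMeasure.ennreal_coeFn_eq_coeFn_toMeasure, hval,
      ENNReal.coe_mul, ENNReal.coe_inv (by positivity)]
    simp
  rw [hval', inv_mul_eq_div, div_le_div_iff₀ (by positivity) (by positivity), one_mul]
  exact_mod_cast (mul_comm c (m + 1)).trans_le hcn.le

/-- The bound `p ≤ e^{-nb}`, in multiplicative form, gives `-(1/n) log p ≥ b`. -/
lemma le_negLogRate {n : ℕ} (hn : n ≠ 0) {b : ℝ} {p : ℝ≥0∞}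
    (hp : ENNReal.ofReal (2 * Real.exp b) ^ n * p ≤ 2 ^ n) : (b : EReal) ≤ negLogRate n p := by
  have hn' : (n : ℝ) ≠ 0 := by exact_mod_cast hn
  have hp1 : ENNReal.ofReal (Real.exp b) ^ n * p ≤ 1 := by
    rw [ENNReal.ofReal_mul zero_le_two, mul_pow, mul_assoc, ENNReal.ofReal_ofNat] at hp
    exact (ENNReal.mul_le_mul_iff_right (pow_ne_zero n two_ne_zero)
      (ENNReal.pow_ne_top ENNReal.ofNat_ne_top)).1 (hp.trans_eq (mul_one _).symm)
  have hp' : p ≤ ENNReal.ofReal (Real.exp (-b)) ^ n := by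
    calc p = ENNReal.ofReal (Real.exp (-b)) ^ n * (ENNReal.ofReal (Real.exp b) ^ n * p) := by
          rw [← mul_assoc, ← mul_pow, ← ENNReal.ofReal_mul (Real.exp_nonneg _), ← Real.exp_add]
          simp
      _ ≤ ENNReal.ofReal (Real.exp (-b)) ^ n * 1 := mul_le_mul_right hp1 _
      _ = _ := mul_one _
  have hlog : ENNReal.log p ≤ ((n * -b : ℝ) : EReal) := by
    refine (ENNReal.log_le_log hp').trans_eq ?_
    rw [ENNReal.log_pow, ENNReal.log_ofReal_of_pos (Real.exp_pos _), Real.log_exp, EReal.coe_mul,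
      EReal.coe_natCast]
  calc (b : EReal) = -((((n : ℝ)⁻¹ : ℝ) : EReal) * ((n * -b : ℝ) : EReal)) := by
        rw [← EReal.coe_mul, ← EReal.coe_neg, inv_mul_cancel_left₀ hn', neg_neg]
    _ ≤ -((((n : ℝ)⁻¹ : ℝ) : EReal) * ENNReal.log p) :=
        EReal.neg_le_neg_iff.2 (mul_le_mul_of_nonneg_left hlog (EReal.coe_nonneg.2 (by positivity)))
    _ = negLogRate n p := (neg_mul _ _).symm

/-- **Exponential tightness of the empirical measures.** For a Polish space `X` and i.i.d.
samples from `P`, for every `b ∈ (0,∞)` there is a compact set `𝒦_b ⊆ 𝒫(X)` (weak topology)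
with `liminf_n -(1/n) log ℙ{L_{X^n} ∈ 𝒦_b^c} ≥ b`. -/
theorem empirical_exponentially_tight {X : Type*} [MeasurableSpace X] [TopologicalSpace X]
    [PolishSpace X] [BorelSpace X] (P : Measure X) [IsProbabilityMeasure P] :
    ∀ b : ℝ, 0 < b → ∃ K : Set (ProbabilityMeasure X), IsCompact K ∧
      (b : EReal) ≤ liminf (fun n : ℕ =>
        negLogRate (n + 1)
          ((Measure.pi fun _ : Fin (n + 1) => P) {x | empDist x ∈ Kᶜ})) atTop := by
  intro b hb
  set R : ℝ≥0∞ := ENNReal.ofReal (2 * Real.exp b) with hRdef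
  have hR : 1 ≤ R := by
    rw [hRdef, ENNReal.one_le_ofReal]
    linarith [Real.one_le_exp hb.le]
  obtain ⟨Γ, W, hΓ, hWm, hW1, hWΓ, hWint⟩ := exists_compact_exhaustion_lintegral_weight_le P
    (ENNReal.ofReal_ne_top : R ≠ ⊤)
  let _ := TopologicalSpace.upgradeIsCompletelyMetrizable X
  refine ⟨{μ | ∀ m : ℕ, μ (Γ m)ᶜ ≤ 1 / ((m : ℝ≥0) + 1)},
    isCompact_setOfPred_probabilityMeasure_mass_eq_compl_isCompact_le
      tendsto_one_div_add_atTop_nhds_zero_nat hΓ (.inl inferInstance), ?_⟩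
  refine le_liminf_of_le (by isBoundedDefault) (.of_forall fun n => ?_)
  refine le_negLogRate n.succ_ne_zero ?_
  calc _ ≤ R ^ (n + 1) *
        (Measure.pi fun _ : Fin (n + 1) => P) {x | R ^ (n + 1) ≤ ∏ i, W (x i)} := by
        gcongr with x
        intro hx
        by_contra! hlt
        exact hx fun m => empDist_le_of_prod_lt hW1 hR (hΓ m).isClosed.measurableSet.compl
          (hWΓ m) hlt
    _ ≤ (∫⁻ x, W x ∂P) ^ (n + 1) := pow_mul_measure_pi_le_prod_le P hWm R (n + 1)
    _ ≤ 2 ^ (n + 1) := by gcongr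
end

section
/- Let 𝒳 be a Polish space, let P be a Borel probability measure on 𝒳, let X_1, X_2, … be i.i.d. with law P, and let L_{X^n} = (1/n)∑_{i=1}^n δ_{X_i}. Let Γ be a completely convex Borel set of Borel probability measures on 𝒳 such that I_Γ := D(Γ°‖P) = D(cl Γ‖P), where Γ° and cl Γ are the interior and closure of Γ in the weak topology, and assume ℙ{L_{X^n} ∈ Γ} > 0 for all large n. Let Q* be the unique probability measure attaining D(cl Γ‖P), and define the conditional laws Q_n(B) := ℙ{X_1 ∈ B | L_{X^n} ∈ Γ}. Then lim_{n→∞} D(Q_n‖Q*) = 0; in particular Q_n → Q* in the weak topology. -/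
open MeasureTheory Filter Topology
open scoped ENNReal NNReal Classical

universe u

/-- Relative entropy `D(Q‖P)`: `∫ log (dQ/dP) dQ` if `Q ≪ P` (and the integral is
well-defined), `+∞` otherwise. -/
noncomputable def relEnt {X : Type*} [MeasurableSpace X] (Q P : Measure X) : ℝ≥0∞ :=
  if Q ≪ P ∧ Integrable (llr Q P) Q then ENNReal.ofReal (∫ x, llr Q P x ∂Q) else ⊤

/-- A set `Γ` of probability measures is completely convex if it is stable under mixtures of
Markov kernels with values in `Γ` over arbitrary probability spaces. -/
def CompletelyConvexP {X : Type*} [mX : MeasurableSpace X]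
    (Γ : Set (ProbabilityMeasure X)) : Prop :=
  ∀ (Z : Type u) (mZ : MeasurableSpace Z) (QZ : @MeasureTheory.Measure Z mZ)
    (_ : @IsProbabilityMeasure Z mZ QZ) (κ : @ProbabilityTheory.Kernel Z X mZ mX)
    (_ : @ProbabilityTheory.IsMarkovKernel Z X mZ mX κ),
    (∀ z : Z, ∃ ν ∈ Γ, (ν : Measure X) = κ z) →
    ∀ ρ : ProbabilityMeasure X,
      (ρ : Measure X) = @MeasureTheory.Measure.bind Z X mZ mX QZ (DFunLike.coe κ) → ρ ∈ Γ

open ProbabilityTheory InformationTheory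

section RelativeEntropy

variable {α : Type*} [MeasurableSpace α]

lemma relEnt_eq_klDiv (Q P : Measure α) [IsProbabilityMeasure Q] [IsProbabilityMeasure P] :
    relEnt Q P = klDiv Q P := by
  unfold relEnt
  split_ifs with h
  · rw [klDiv_of_ac_of_integrable h.1 h.2]
    simp
  · exact (klDiv_eq_top_iff.2 fun h1 h2 => h ⟨h1, h2⟩).symm

/-- The Fenchel–Young inequality for `x log x`. -/
lemma mul_le_klFun_add_exp_sub_one {h : ℝ} (hh : 0 ≤ h) (u : ℝ) :
    h * u ≤ klFun h + (Real.exp u - 1) := by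
  rw [klFun_apply]
  rcases hh.eq_or_lt with rfl | hh
  · simpa using (Real.exp_pos u).le
  · have h1 := Real.add_one_le_exp (u - Real.log h)
    rw [Real.exp_sub, Real.exp_log hh, le_div_iff₀ hh] at h1
    nlinarith

/-- A quantitative form of the fact that convergence in relative entropy implies convergence of
integrals of bounded functions. -/
lemma integral_sub_integral_le_klDiv {Q S : Measure α} [IsProbabilityMeasure Q]
    [IsProbabilityMeasure S] (hfin : klDiv Q S ≠ ∞) {f : α → ℝ} (hf : Measurable f) {M : ℝ}
    (hM : ∀ x, |f x| ≤ M) {t : ℝ} (ht : 0 < t) (htM : t * M ≤ 1) :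
    ∫ x, f x ∂Q - ∫ x, f x ∂S ≤ (klDiv Q S).toReal / t + t * M ^ 2 := by
  obtain ⟨hac, hint⟩ := klDiv_ne_top_iff.1 hfin
  have hfS : Integrable f S := .of_bound hf.aestronglyMeasurable M (ae_of_all _ hM)
  have hfQ : Integrable f Q := .of_bound hf.aestronglyMeasurable M (ae_of_all _ hM)
  have hkl : Integrable (fun x => klFun (Q.rnDeriv S x).toReal) S :=
    (integrable_klFun_rnDeriv_iff hac).2 hint
  have hfQ' : Integrable (fun x => (Q.rnDeriv S x).toReal * f x) S := by
    simpa using (integrable_rnDeriv_smul_iff hac).2 hfQ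
  have hsum : Integrable (fun x => t * f x + t ^ 2 * M ^ 2) S :=
    (hfS.const_mul t).add (integrable_const _)
  have key : ∫ x, t * ((Q.rnDeriv S x).toReal * f x) ∂S
      ≤ ∫ x, (klFun (Q.rnDeriv S x).toReal + (t * f x + t ^ 2 * M ^ 2)) ∂S := by
    refine integral_mono (hfQ'.const_mul t)
      (hkl.add hsum) fun x => ?_
    have h1 := mul_le_klFun_add_exp_sub_one (h := (Q.rnDeriv S x).toReal)
      ENNReal.toReal_nonneg (t * f x)
    have h2 : |t * f x| ≤ t * M := by
      rw [abs_mul, abs_of_pos ht]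
      exact mul_le_mul_of_nonneg_left (hM x) ht.le
    have h3 := (abs_le.1 (Real.abs_exp_sub_one_sub_id_le (h2.trans htM))).2
    have h4 : (t * f x) ^ 2 ≤ (t * M) ^ 2 := sq_le_sq' (abs_le.1 h2).1 (abs_le.1 h2).2
    simp only
    nlinarith
  rw [integral_const_mul, integral_add hkl hsum,
    integral_add (hfS.const_mul t) (integrable_const _), integral_const_mul,
    ← toReal_klDiv_eq_integral_klFun hac] at key
  have hrn : ∫ x, (Q.rnDeriv S x).toReal * f x ∂S = ∫ x, f x ∂Q := by
    simpa using integral_rnDeriv_smul (f := f) hac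
  rw [hrn] at key
  simp only [integral_const, probReal_univ, smul_eq_mul, one_mul] at key
  rw [div_add' _ _ _ ht.ne', le_div_iff₀ ht]
  nlinarith

lemma tendsto_integral_of_tendsto_klDiv {ι : Type*} {l : Filter ι} {Q : ι → Measure α}
    {S : Measure α} [IsProbabilityMeasure S] (hQ : ∀ᶠ i in l, IsProbabilityMeasure (Q i))
    (h : Tendsto (fun i => klDiv (Q i) S) l (𝓝 0)) {f : α → ℝ} (hf : Measurable f) {M : ℝ}
    (hM : ∀ x, |f x| ≤ M) :
    Tendsto (fun i => ∫ x, f x ∂(Q i)) l (𝓝 (∫ x, f x ∂S)) := by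
  have hM0 : 0 ≤ M := by
    obtain ⟨x⟩ := nonempty_of_isProbabilityMeasure S
    exact (abs_nonneg _).trans (hM x)
  rw [Metric.tendsto_nhds]
  intro ε hε
  obtain ⟨t, ht, htM, htε⟩ : ∃ t : ℝ, 0 < t ∧ t * M ≤ 1 ∧ t * M ^ 2 < ε / 2 := by
    have h1 : Tendsto (fun t : ℝ => t * M) (𝓝[>] 0) (𝓝 0) := by
      have : Continuous fun t : ℝ => t * M := by fun_prop
      simpa using (this.tendsto 0).mono_left nhdsWithin_le_nhds
    have h2 : Tendsto (fun t : ℝ => t * M ^ 2) (𝓝[>] 0) (𝓝 0) := by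
      have : Continuous fun t : ℝ => t * M ^ 2 := by fun_prop
      simpa using (this.tendsto 0).mono_left nhdsWithin_le_nhds
    obtain ⟨t, ⟨h3, h4⟩, h5⟩ := (((h1.eventually_le_const zero_lt_one).and
      (h2.eventually_lt_const (half_pos hε))).and self_mem_nhdsWithin).exists
    exact ⟨t, h5, h3, h4⟩
  have hsmall : ∀ᶠ i in l, klDiv (Q i) S < ENNReal.ofReal (ε / 2 * t) :=
    h.eventually_lt_const (by simpa using by positivity)
  filter_upwards [hQ, hsmall] with i hi hlt
  have hfin : klDiv (Q i) S ≠ ∞ := (hlt.trans ENNReal.ofReal_lt_top).ne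
  have hlt' : (klDiv (Q i) S).toReal / t < ε / 2 := by
    rw [div_lt_iff₀ ht]
    exact (ENNReal.lt_ofReal_iff_toReal_lt hfin).1 hlt
  have h1 := integral_sub_integral_le_klDiv hfin hf hM ht htM
  have h2 := integral_sub_integral_le_klDiv hfin hf.neg (M := M) (by simpa using hM) ht htM
  simp only [Pi.neg_apply, integral_neg] at h2
  rw [Real.dist_eq, abs_lt]
  constructor <;> linarith

end RelativeEntropy

section Pythagoras

variable {α : Type*} [MeasurableSpace α]

lemma klDiv_withDensity_eq_lintegral {P M : Measure α} [IsFiniteMeasure P] [IsFiniteMeasure M]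
    {m : α → ℝ≥0∞} (hm : Measurable m) (h : M = P.withDensity m) :
    klDiv M P = ∫⁻ x, ENNReal.ofReal (klFun (m x).toReal) ∂P := by
  have hac : M ≪ P := h ▸ withDensity_absolutelyContinuous P m
  rw [klDiv_eq_lintegral_klFun_of_ac hac]
  refine lintegral_congr_ae ?_
  have := Measure.rnDeriv_withDensity P hm
  rw [← h] at this
  filter_upwards [this] with x hx
  rw [hx]

lemma tendsto_convexity_gap_klFun {q s : ℝ} (hs : 0 < s) :
    Tendsto (fun n : ℕ => klFun q + n * klFun s - (n + 1) * klFun ((n * s + q) / (n + 1))) atTop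
      (𝓝 (s * klFun (q / s))) := by
  have hd : HasDerivAt (fun t : ℝ => klFun (s + t * (q - s))) (Real.log s * (q - s)) 0 := by
    have h1 : HasDerivAt klFun (Real.log s) (s + 0 * (q - s)) := by
      simpa using hasDerivAt_klFun hs.ne'
    have h2 : HasDerivAt (fun t : ℝ => s + t * (q - s)) (q - s) 0 := by
      simpa using ((hasDerivAt_id (0 : ℝ)).mul_const (q - s)).const_add s
    exact h1.comp 0 h2
  rw [hasDerivAt_iff_tendsto_slope_zero] at hd
  have hseq : Tendsto (fun n : ℕ => 1 / ((n : ℝ) + 1)) atTop (𝓝[≠] 0) :=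
    tendsto_nhdsWithin_iff.2 ⟨tendsto_one_div_add_atTop_nhds_zero_nat,
      Eventually.of_forall fun n => (by positivity : (0 : ℝ) < 1 / ((n : ℝ) + 1)).ne'⟩
  have hlim := (tendsto_const_nhds (x := klFun q - klFun s)).sub (hd.comp hseq)
  have heq : klFun q - klFun s - Real.log s * (q - s) = s * klFun (q / s) := by
    rcases eq_or_ne q 0 with rfl | hq
    · simp [klFun_apply]
      ring
    · simp only [klFun_apply]
      rw [Real.log_div hq hs.ne']
      field_simp
      ring
  rw [heq] at hlim
  refine hlim.congr fun n => ?_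
  have hn : (n : ℝ) + 1 ≠ 0 := by positivity
  have h3 : s + 1 / ((n : ℝ) + 1) * (q - s) = (n * s + q) / (n + 1) := by
    field_simp
    ring
  simp only [Function.comp_apply, zero_add, zero_mul, add_zero, smul_eq_mul, h3]
  rw [one_div, inv_inv]
  ring

lemma tendsto_convexity_gap_klFun_zero {q : ℝ} (hq : 0 < q) :
    Tendsto (fun n : ℕ => klFun q + n * klFun 0 - (n + 1) * klFun ((n * 0 + q) / (n + 1))) atTop
      atTop := by
  have h1 : Tendsto (fun n : ℕ => q * Real.log ((n : ℝ) + 1)) atTop atTop :=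
    (Real.tendsto_log_atTop.comp
      (tendsto_natCast_atTop_atTop.atTop_add tendsto_const_nhds)).const_mul_atTop hq
  refine h1.congr fun n => ?_
  have hn : (n : ℝ) + 1 ≠ 0 := by positivity
  simp only [klFun_apply, mul_zero, zero_add]
  rw [Real.log_div hq.ne' hn]
  simp
  field_simp
  ring

/-- The gap in the convexity inequality of `klFun` at the point `(n * s + q) / (n + 1)`. -/
lemma convexity_gap_klFun_nonneg {q s : ℝ} (hq : 0 ≤ q) (hs : 0 ≤ s) (n : ℕ) :
    0 ≤ klFun q + n * klFun s - (n + 1) * klFun ((n * s + q) / (n + 1)) := by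
  have hn : (0 : ℝ) < n + 1 := by positivity
  have ha : (0 : ℝ) ≤ n / (n + 1) := by positivity
  have hb : (0 : ℝ) ≤ 1 / (n + 1) := by positivity
  have h := convexOn_klFun.2 (Set.mem_Ici.2 hs) (Set.mem_Ici.2 hq) ha hb (by field_simp)
  simp only [smul_eq_mul] at h
  have h3 : (n : ℝ) / (n + 1) * s + 1 / (n + 1) * q = (n * s + q) / (n + 1) := by
    field_simp
  rw [h3] at h
  have h4 := mul_le_mul_of_nonneg_left h hn.le
  have h5 : ((n : ℝ) + 1) * (n / (n + 1) * klFun s + 1 / (n + 1) * klFun q)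
      = n * klFun s + klFun q := by
    field_simp
  linarith

/-- The Pythagorean inequality for relative entropy: if `S` minimizes the relative entropy
with respect to `P` along the segment from `S` to `Q`, then
`D(Q‖S) + D(S‖P) ≤ D(Q‖P)`. -/
lemma klDiv_add_klDiv_le {P Q S : Measure α} [IsProbabilityMeasure P] [IsProbabilityMeasure Q]
    [IsProbabilityMeasure S] (hQ : klDiv Q P ≠ ∞) (hS : klDiv S P ≠ ∞)
    (hmin : ∀ n : ℕ, klDiv S P ≤ klDiv (((n + 1 : ℕ) : ℝ≥0∞)⁻¹ • ((n : ℝ≥0∞) • S + Q)) P) :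
    klDiv Q S + klDiv S P ≤ klDiv Q P := by
  obtain ⟨hQac, hQint⟩ := klDiv_ne_top_iff.1 hQ
  obtain ⟨hSac, hSint⟩ := klDiv_ne_top_iff.1 hS
  set q : α → ℝ := fun x => (Q.rnDeriv P x).toReal with hq
  set s : α → ℝ := fun x => (S.rnDeriv P x).toReal with hs
  have hqm : Measurable q := (Measure.measurable_rnDeriv _ _).ennreal_toReal
  have hsm : Measurable s := (Measure.measurable_rnDeriv _ _).ennreal_toReal
  have hq0 : ∀ x, 0 ≤ q x := fun x => ENNReal.toReal_nonneg
  have hs0 : ∀ x, 0 ≤ s x := fun x => ENNReal.toReal_nonneg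
  have hqi : Integrable (fun x => klFun (q x)) P := (integrable_klFun_rnDeriv_iff hQac).2 hQint
  have hsi : Integrable (fun x => klFun (s x)) P := (integrable_klFun_rnDeriv_iff hSac).2 hSint
  set m : ℕ → α → ℝ := fun n x => (n * s x + q x) / (n + 1) with hm
  have hmm : ∀ n, Measurable (m n) := fun n => ((hsm.const_mul _).add hqm).div_const _
  have hm0 : ∀ n x, 0 ≤ m n x := fun n x =>
    div_nonneg (add_nonneg (mul_nonneg n.cast_nonneg (hs0 x)) (hq0 x)) (by positivity)
  set g : ℕ → α → ℝ := fun n x => klFun (q x) + n * klFun (s x) - (n + 1) * klFun (m n x) with hg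
  have hg0 : ∀ n x, 0 ≤ g n x := fun n x => convexity_gap_klFun_nonneg (hq0 x) (hs0 x) n
  have hgm : ∀ n, Measurable (g n) := fun n =>
    ((measurable_klFun.comp hqm).add ((measurable_klFun.comp hsm).const_mul _)).sub
      ((measurable_klFun.comp (hmm n)).const_mul _)
  have hmi : ∀ n, Integrable (fun x => klFun (m n x)) P := by
    intro n
    refine (hqi.add (hsi.const_mul (n : ℝ))).mono'
      (measurable_klFun.comp (hmm n)).aestronglyMeasurable (ae_of_all _ fun x => ?_)
    have h1 := hg0 n x
    have h2 := klFun_nonneg (hm0 n x)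
    have h3 : (0 : ℝ) ≤ n * klFun (m n x) := mul_nonneg n.cast_nonneg h2
    rw [Real.norm_of_nonneg h2]
    simp only [hg] at h1
    simp only [Pi.add_apply]
    linarith
  have hDm : ∀ n, (klDiv S P).toReal ≤ ∫ x, klFun (m n x) ∂P := by
    intro n
    set M := ((n + 1 : ℕ) : ℝ≥0∞)⁻¹ • ((n : ℝ≥0∞) • S + Q)
    have hM : M = P.withDensity (fun x => ENNReal.ofReal (m n x)) := by
      have h1 : ((n + 1 : ℕ) : ℝ≥0∞)⁻¹ • ((n : ℝ≥0∞) • S.rnDeriv P + Q.rnDeriv P)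
          =ᵐ[P] fun x => ENNReal.ofReal (m n x) := by
        filter_upwards [Q.rnDeriv_lt_top P, S.rnDeriv_lt_top P] with x hx1 hx2
        have hn : (0 : ℝ) < (n + 1 : ℕ) := by positivity
        have e1 : (n + 1 : ℝ) = ((n + 1 : ℕ) : ℝ) := by push_cast; rfl
        simp only [hm, hq, hs, Pi.smul_apply, Pi.add_apply, smul_eq_mul]
        rw [e1, ENNReal.ofReal_div_of_pos hn, ENNReal.ofReal_add
          (mul_nonneg n.cast_nonneg ENNReal.toReal_nonneg) ENNReal.toReal_nonneg,
          ENNReal.ofReal_mul n.cast_nonneg, ENNReal.ofReal_natCast, ENNReal.ofReal_natCast,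
          ENNReal.ofReal_toReal hx1.ne, ENNReal.ofReal_toReal hx2.ne, ENNReal.div_eq_inv_mul]
      rw [← withDensity_congr_ae h1,
        withDensity_smul _ (((Measure.measurable_rnDeriv _ _).const_smul _).add
          (Measure.measurable_rnDeriv _ _)),
        withDensity_add_right _ (Measure.measurable_rnDeriv _ _),
        withDensity_smul _ (Measure.measurable_rnDeriv _ _),
        Measure.withDensity_rnDeriv_eq _ _ hSac, Measure.withDensity_rnDeriv_eq _ _ hQac]
    have hMfin : IsFiniteMeasure M := by
      constructor
      have : ((n + 1 : ℕ) : ℝ≥0∞)⁻¹ ≠ ∞ := by simp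
      simp only [M, Measure.smul_apply, Measure.add_apply, measure_univ, smul_eq_mul]
      exact ENNReal.mul_lt_top this.lt_top (by simp)
    have h2 := hmin n
    rw [klDiv_withDensity_eq_lintegral (hmm n).ennreal_ofReal hM] at h2
    simp only [ENNReal.toReal_ofReal (hm0 n _)] at h2
    rw [← ofReal_integral_eq_lintegral_ofReal (hmi n)
      (ae_of_all _ fun x => klFun_nonneg (hm0 n x))] at h2
    exact ENNReal.toReal_le_of_le_ofReal (integral_nonneg fun x => klFun_nonneg (hm0 n x)) h2
  have hbound : ∀ n, ∫⁻ x, ENNReal.ofReal (g n x) ∂P ≤ klDiv Q P - klDiv S P := by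
    intro n
    have hi1 : Integrable (fun x => (n : ℝ) * klFun (s x)) P := hsi.const_mul _
    have hi2 : Integrable (fun x => ((n : ℝ) + 1) * klFun (m n x)) P := (hmi n).const_mul _
    have hi3 : Integrable (fun x => klFun (q x) + n * klFun (s x)) P := hqi.add hi1
    have hgi : Integrable (g n) P := hi3.sub hi2
    rw [← ofReal_integral_eq_lintegral_ofReal hgi (ae_of_all _ (hg0 n)),
      ← ENNReal.ofReal_toReal hQ, ← ENNReal.ofReal_toReal hS,
      ← ENNReal.ofReal_sub _ ENNReal.toReal_nonneg]
    refine ENNReal.ofReal_le_ofReal ?_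
    have h1 : ∫ x, g n x ∂P = ∫ x, klFun (q x) ∂P + n * ∫ x, klFun (s x) ∂P
        - (n + 1) * ∫ x, klFun (m n x) ∂P := by
      simp only [hg]
      rw [integral_sub hi3 hi2, integral_add hqi hi1, integral_const_mul,
        integral_const_mul]
    rw [h1, toReal_klDiv_eq_integral_klFun hQac, toReal_klDiv_eq_integral_klFun hSac]
    have h2 := mul_le_mul_of_nonneg_left (hDm n) (by positivity : (0 : ℝ) ≤ (n : ℝ) + 1)
    rw [toReal_klDiv_eq_integral_klFun hSac] at h2
    linarith
  set G : α → ℝ≥0∞ := fun x => liminf (fun n => ENNReal.ofReal (g n x)) atTop with hG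
  have hGm : Measurable G := Measurable.liminf fun n => (hgm n).ennreal_ofReal
  have hGle : ∫⁻ x, G x ∂P ≤ klDiv Q P - klDiv S P :=
    (lintegral_liminf_le fun n => (hgm n).ennreal_ofReal).trans
      (liminf_le_of_frequently_le' (Eventually.of_forall hbound).frequently)
  have hGtop : ∀ᵐ x ∂P, G x < ∞ :=
    ae_lt_top hGm (hGle.trans_lt (tsub_le_self.trans_lt hQ.lt_top)).ne
  have hsupp : ∀ᵐ x ∂P, s x = 0 → q x = 0 := by
    filter_upwards [hGtop] with x hx hsx
    by_contra hne
    have h1 := tendsto_convexity_gap_klFun_zero (lt_of_le_of_ne (hq0 x) (Ne.symm hne))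
    have h2 : Tendsto (fun n => ENNReal.ofReal (g n x)) atTop (𝓝 ∞) := by
      refine ENNReal.tendsto_ofReal_atTop.comp ?_
      simpa only [hg, hm, hsx] using h1
    exact hx.ne h2.liminf_eq
  have hQS : Q ≪ S := by
    refine Measure.AbsolutelyContinuous.mk fun A hA hSA => ?_
    rw [← Measure.withDensity_rnDeriv_eq _ _ hSac, withDensity_apply _ hA,
      lintegral_eq_zero_iff (Measure.measurable_rnDeriv _ _)] at hSA
    rw [← Measure.withDensity_rnDeriv_eq _ _ hQac, withDensity_apply _ hA,
      lintegral_eq_zero_iff (Measure.measurable_rnDeriv _ _)]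
    filter_upwards [hSA, ae_restrict_of_ae hsupp, ae_restrict_of_ae (Q.rnDeriv_lt_top P)]
      with x h1 h2 h3
    have h4 := h2 (by simp [hs, h1])
    exact ((ENNReal.toReal_eq_zero_iff _).1 h4).resolve_right h3.ne
  have hfinal : klDiv Q S ≤ ∫⁻ x, G x ∂P := by
    have hkm : Measurable fun x => ENNReal.ofReal (klFun (Q.rnDeriv S x).toReal) :=
      (measurable_klFun.comp (Measure.measurable_rnDeriv _ _).ennreal_toReal).ennreal_ofReal
    rw [klDiv_eq_lintegral_klFun_of_ac hQS, ← lintegral_rnDeriv_mul hSac hkm.aemeasurable]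
    refine lintegral_mono_ae ?_
    filter_upwards [Measure.rnDeriv_mul_rnDeriv (κ := P) hQS, S.rnDeriv_lt_top P] with x hx hx2
    have hmul : (Q.rnDeriv S x).toReal * s x = q x := by
      simp only [hs, hq]
      rw [← hx, Pi.mul_apply, ENNReal.toReal_mul]
    rcases (hs0 x).eq_or_lt with h0 | h0
    · have : S.rnDeriv P x = 0 :=
        ((ENNReal.toReal_eq_zero_iff _).1 h0.symm).resolve_right hx2.ne
      simp [this]
    · have h1 := (ENNReal.tendsto_ofReal (tendsto_convexity_gap_klFun (q := q x) h0)).liminf_eq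
      have h2 : q x / s x = (Q.rnDeriv S x).toReal := by
        rw [← hmul, mul_div_cancel_right₀ _ h0.ne']
      rw [h2, ENNReal.ofReal_mul h0.le] at h1
      simp only [hG, hg, hm]
      rw [h1]
      simp only [hs]
      rw [ENNReal.ofReal_toReal hx2.ne]
  have hSQ : klDiv S P ≤ klDiv Q P := by
    have := hmin 0
    simpa using this
  calc klDiv Q S + klDiv S P ≤ (klDiv Q P - klDiv S P) + klDiv S P := by
        gcongr
        exact hfinal.trans hGle
    _ = klDiv Q P := tsub_add_cancel_of_le hSQ

end Pythagoras

section ProductMeasure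

variable {α : Type*} [MeasurableSpace α]

lemma measurePreserving_pi_comp_perm (P : Measure α) [IsProbabilityMeasure P] {n : ℕ}
    (σ : Equiv.Perm (Fin n)) :
    MeasurePreserving (fun (x : Fin n → α) i => x (σ i)) (Measure.pi fun _ => P)
      (Measure.pi fun _ => P) := by
  refine ⟨by fun_prop, ?_⟩
  have := Measure.map_infinitePi_infinitePi_of_inj (P := fun _ : Fin n => P) σ.injective
  simpa [Measure.infinitePi_eq_pi] using this

lemma measurePreserving_infinitePi_restrict (P : Measure α) [IsProbabilityMeasure P] (n : ℕ) :
    MeasurePreserving (fun (ω : ℕ → α) (i : Fin n) => ω i) (Measure.infinitePi fun _ => P)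
      (Measure.pi fun _ => P) := by
  refine ⟨by fun_prop, ?_⟩
  have := Measure.map_infinitePi_infinitePi_of_inj (P := fun _ : ℕ => P)
    (Fin.val_injective (n := n))
  simpa [Measure.infinitePi_eq_pi] using this

/-- The weak law of large numbers for product measures. -/
lemma tendsto_pi_measure_average_sub_integral {Q : Measure α} [IsProbabilityMeasure Q]
    {f : α → ℝ} (hf : Measurable f) (hfi : Integrable f Q) {ε : ℝ} (hε : 0 < ε) :
    Tendsto (fun n : ℕ => (Measure.pi fun _ : Fin (n + 1) => Q)
      {x | ε ≤ |(∑ i, f (x i)) / ((n + 1 : ℕ) : ℝ) - ∫ y, f y ∂Q|}) atTop (𝓝 0) := by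
  set μ := Measure.infinitePi fun _ : ℕ => Q
  have hmp : ∀ i : ℕ, MeasurePreserving (fun ω : ℕ → α => ω i) μ Q := fun i =>
    ⟨by fun_prop, Measure.infinitePi_map_eval _ i⟩
  have hslln := strong_law_ae_real (μ := μ) (fun i ω => f (ω i))
    ((hmp 0).integrable_comp_of_integrable hfi)
    (fun i j hij => (iIndepFun_infinitePi (P := fun _ : ℕ => Q) (X := fun _ => f)
      fun _ => hf).indepFun hij)
    (fun i => ⟨(hf.comp (hmp i).measurable).aemeasurable, (hf.comp (hmp 0).measurable).aemeasurable,
    by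
      rw [← Function.comp_def f, ← Function.comp_def f, ← Measure.map_map hf (hmp i).measurable,
        ← Measure.map_map hf (hmp 0).measurable, (hmp i).map_eq, (hmp 0).map_eq]⟩)
  have hint : ∫ ω, f (ω 0) ∂μ = ∫ y, f y ∂Q := by
    rw [← (hmp 0).map_eq, integral_map (hmp 0).measurable.aemeasurable hf.aestronglyMeasurable]
  rw [hint] at hslln
  have hmeas := tendstoInMeasure_of_tendsto_ae
    (fun n => (by fun_prop : Measurable fun ω : ℕ → α =>
      (∑ i ∈ Finset.range n, f (ω i)) / (n : ℝ)).aestronglyMeasurable) hslln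
  rw [tendstoInMeasure_iff_norm] at hmeas
  refine ((hmeas ε hε).comp (tendsto_add_atTop_nat 1)).congr fun n => ?_
  have hset : MeasurableSet {x : Fin (n + 1) → α |
      ε ≤ |(∑ i, f (x i)) / ((n + 1 : ℕ) : ℝ) - ∫ y, f y ∂Q|} :=
    measurableSet_le measurable_const (by fun_prop)
  rw [← (measurePreserving_infinitePi_restrict Q (n + 1)).measure_preimage hset.nullMeasurableSet]
  simp only [Function.comp_apply, Set.preimage_ofPred_eq, Real.norm_eq_abs, Finset.sum_range]
  rfl

/-- Let `Q` be the law of every coordinate under a product measure conditioned on an event `A`.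
Its relative entropy is at most `-log ℙ(A)` divided by the number of coordinates. -/
lemma klDiv_map_cond_pi_le {P : Measure α} [IsProbabilityMeasure P] {n : ℕ}
    {A : Set (Fin n → α)}
    (hA0 : (Measure.pi fun _ : Fin n => P) A ≠ 0) {Q : Measure α} [IsProbabilityMeasure Q]
    (hQ : ∀ i, Measure.map (fun x : Fin n → α => x i)
      (ProbabilityTheory.cond (Measure.pi fun _ : Fin n => P) A) = Q) (hn : n ≠ 0) :
    klDiv Q P ≠ ∞ ∧
      n * (klDiv Q P).toReal ≤ -Real.log ((Measure.pi fun _ : Fin n => P).real A) := by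
  set π := Measure.pi fun _ : Fin n => P with hπ
  set W := ProbabilityTheory.cond π A with hW
  set c : ℝ≥0∞ := (π A)⁻¹ with hc
  have hctop : c ≠ ∞ := ENNReal.inv_ne_top.2 hA0
  have hp : 0 < π.real A := ENNReal.toReal_pos hA0 (measure_ne_top _ _)
  have hcr : c.toReal = (π.real A)⁻¹ := ENNReal.toReal_inv _
  have hWle : W ≤ c • π := by
    rw [hW, ProbabilityTheory.cond, hc]
    gcongr
    exact Measure.restrict_le_self
  have hWprob : IsProbabilityMeasure W := ProbabilityTheory.cond_isProbabilityMeasure hA0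
  have hev : ∀ i, Measurable fun x : Fin n → α => x i := fun i => measurable_pi_apply i
  have hmap : ∀ i, Measure.map (fun x : Fin n → α => x i) π = P := fun i =>
    (measurePreserving_eval (fun _ => P) i).map_eq
  obtain ⟨i₀⟩ : Nonempty (Fin n) := ⟨⟨0, Nat.pos_of_ne_zero hn⟩⟩
  have hQle : Q ≤ c • P := by
    rw [← hQ i₀, ← hmap i₀, ← Measure.map_smul]
    exact Measure.map_mono hWle (hev i₀)
  have hac : Q ≪ P := Measure.absolutelyContinuous_of_le_smul hQle
  set f : α → ℝ := fun x => (Q.rnDeriv P x).toReal with hf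
  have hfm : Measurable f := (Measure.measurable_rnDeriv _ _).ennreal_toReal
  have hf0 : ∀ x, 0 ≤ f x := fun x => ENNReal.toReal_nonneg
  have hfc : ∀ᵐ x ∂P, f x ≤ c.toReal := by
    have : Q.rnDeriv P ≤ᵐ[P] fun _ => c := by
      refine ae_le_of_forall_setLIntegral_le_of_sigmaFinite (Measure.measurable_rnDeriv _ _)
        fun s hs _ => ?_
      rw [Measure.setLIntegral_rnDeriv hac, setLIntegral_const]
      exact hQle s
    filter_upwards [this] with x hx
    exact ENNReal.toReal_mono hctop hx
  have hfi : Integrable f P := Measure.integrable_toReal_rnDeriv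
  have hint : Integrable (llr Q P) Q := by
    rw [← integrable_klFun_rnDeriv_iff hac]
    obtain ⟨K, hK⟩ := (isCompact_Icc (a := (0 : ℝ)) (b := c.toReal)).exists_bound_of_continuousOn
      continuous_klFun.continuousOn
    refine .of_bound (measurable_klFun.comp hfm).aestronglyMeasurable K ?_
    filter_upwards [hfc] with x hx
    exact hK _ ⟨hf0 x, hx⟩
  refine ⟨klDiv_ne_top hac hint, ?_⟩
  have hkl : (klDiv Q P).toReal = ∫ x, Real.log (f x) ∂Q :=
    toReal_klDiv_of_measure_eq hac (by simp)
  have hlogi : Integrable (fun x => Real.log (f x)) Q := hint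
  have hlogW : ∀ i, Integrable (fun x : Fin n → α => Real.log (f (x i))) W := fun i => by
    have := hlogi
    rw [← hQ i] at this
    exact this.comp_measurable (hev i)
  have hlogQ : ∀ i, ∫ x, Real.log (f (x i)) ∂W = ∫ x, Real.log (f x) ∂Q := fun i => by
    have hlogm : Measurable fun x => Real.log (f x) := Real.measurable_log.comp hfm
    rw [← hQ i, integral_map (hev i).aemeasurable hlogm.aestronglyMeasurable]
  have hsum : n * (klDiv Q P).toReal = ∫ x, ∑ i, Real.log (f (x i)) ∂W := by
    rw [integral_finsetSum _ fun i _ => hlogW i, hkl]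
    simp [hlogQ]
  have hprodi : Integrable (fun x : Fin n → α => ∏ i, f (x i)) π :=
    Integrable.fintype_prod fun _ => hfi
  have hprodW : Integrable (fun x : Fin n → α => ∏ i, f (x i)) W :=
    (hprodi.smul_measure hctop).mono_measure hWle
  have hprodle : ∫ x, ∏ i, f (x i) ∂W ≤ c.toReal := by
    calc ∫ x, ∏ i, f (x i) ∂W ≤ ∫ x, ∏ i, f (x i) ∂(c • π) :=
          integral_mono_measure hWle (ae_of_all _ fun x => Finset.prod_nonneg fun i _ => hf0 _)
            (hprodi.smul_measure hctop)
      _ = c.toReal := by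
          rw [integral_smul_measure, integral_fintype_prod_eq_pow, hf,
            Measure.integral_toReal_rnDeriv hac]
          simp
  have hfpos : ∀ᵐ x ∂W, ∀ i, 0 < f (x i) := by
    rw [ae_all_iff]
    intro i
    have h1 : ∀ᵐ y ∂Q, 0 < f y := by
      filter_upwards [Measure.rnDeriv_pos hac, hac.ae_le (Q.rnDeriv_lt_top P)] with y h1 h2
      exact ENNReal.toReal_pos h1.ne' h2.ne
    rw [← hQ i] at h1
    exact ae_of_ae_map (hev i).aemeasurable h1
  have hle : ∫ x, ∑ i, Real.log (f (x i)) ∂W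
      ≤ ∫ x, (π.real A * ∏ i, f (x i) + (-1 - Real.log (π.real A))) ∂W := by
    refine integral_mono_ae (integrable_finsetSum _ fun i _ => hlogW i)
      ((hprodW.const_mul _).add (integrable_const _)) ?_
    filter_upwards [hfpos] with x hx
    have hprod : 0 < ∏ i, f (x i) := Finset.prod_pos fun i _ => hx i
    have h1 := Real.log_le_sub_one_of_pos (mul_pos hp hprod)
    rw [Real.log_mul hp.ne' hprod.ne', Real.log_prod fun i _ => (hx i).ne'] at h1
    linarith
  rw [integral_add (hprodW.const_mul _) (integrable_const _), integral_const_mul] at hle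
  have h2 := mul_le_mul_of_nonneg_left hprodle hp.le
  rw [hcr, mul_inv_cancel₀ hp.ne'] at h2
  simp only [integral_const, probReal_univ, smul_eq_mul, one_mul] at hle
  rw [hsum]
  linarith

/-- The product of a measure with density is the product measure with the product density. -/
lemma pi_withDensity_ofReal {P Q : Measure α} [IsProbabilityMeasure P] [IsProbabilityMeasure Q]
    {f : α → ℝ} (hf0 : ∀ x, 0 ≤ f x) (hfi : Integrable f P)
    (hQ : Q = P.withDensity fun x => ENNReal.ofReal (f x)) (n : ℕ) :
    (Measure.pi fun _ : Fin n => Q)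
      = (Measure.pi fun _ : Fin n => P).withDensity fun x => ENNReal.ofReal (∏ i, f (x i)) := by
  refine Measure.pi_eq (μ := fun _ : Fin n => Q) fun s hs => ?_
  rw [withDensity_apply _ (MeasurableSet.univ_pi hs), ← lintegral_indicator (.univ_pi hs)]
  have h1 : (Set.univ.pi s).indicator (fun x : Fin n → α => ENNReal.ofReal (∏ i, f (x i)))
      = fun x => ENNReal.ofReal (∏ i, (s i).indicator f (x i)) := by
    funext x
    by_cases hx : x ∈ Set.univ.pi s
    · rw [Set.indicator_of_mem hx]
      congr 1
      exact Finset.prod_congr rfl fun i _ => (Set.indicator_of_mem (hx i trivial) f).symm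
    · rw [Set.indicator_of_notMem hx]
      obtain ⟨i, hi⟩ : ∃ i, x i ∉ s i := by simpa using hx
      rw [Finset.prod_eq_zero (Finset.mem_univ i) (Set.indicator_of_notMem hi f)]
      simp
  have hind0 : ∀ i x, 0 ≤ (s i).indicator f x := fun i x =>
    Set.indicator_nonneg (fun y _ => hf0 y) x
  rw [h1, ← ofReal_integral_eq_lintegral_ofReal
    (Integrable.fintype_prod fun i => hfi.indicator (hs i))
    (ae_of_all _ fun x => Finset.prod_nonneg fun i _ => hind0 i _),
    integral_fintype_prod_eq_prod, ENNReal.ofReal_prod_of_nonneg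
    fun i _ => integral_nonneg fun x => hind0 i x]
  refine Finset.prod_congr rfl fun i _ => ?_
  rw [integral_indicator (hs i), hQ, withDensity_apply _ (hs i),
    ofReal_integral_eq_lintegral_ofReal hfi.integrableOn (ae_of_all _ hf0)]

/-- Change of measure: an event which becomes likely under i.i.d. sampling from `Q` has probability
at least `exp (-(n + 1) * (D(Q‖P) + δ))` under i.i.d. sampling from `P`, for large `n`. -/
lemma eventually_exp_le_pi_measureReal {P Q : Measure α} [IsProbabilityMeasure P]
    [IsProbabilityMeasure Q] (hfin : klDiv Q P ≠ ∞) {A : ∀ n : ℕ, Set (Fin (n + 1) → α)}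
    (hA : ∀ n, MeasurableSet (A n))
    (hlim : Tendsto (fun n => (Measure.pi fun _ : Fin (n + 1) => Q) (A n)ᶜ) atTop (𝓝 0))
    {δ : ℝ} (hδ : 0 < δ) :
    ∀ᶠ n : ℕ in atTop, Real.exp (-((n + 1 : ℕ) * ((klDiv Q P).toReal + δ)))
      ≤ (Measure.pi fun _ : Fin (n + 1) => P).real (A n) := by
  obtain ⟨hac, hint⟩ := klDiv_ne_top_iff.1 hfin
  set D := (klDiv Q P).toReal with hD
  have hDint : D = ∫ x, llr Q P x ∂Q := toReal_klDiv_of_measure_eq hac (by simp)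
  have hllr := tendsto_pi_measure_average_sub_integral (measurable_llr Q P) hint (half_pos hδ)
  rw [← hDint] at hllr
  set f : α → ℝ := fun x => (Q.rnDeriv P x).toReal with hf
  have hfm : Measurable f := (Measure.measurable_rnDeriv _ _).ennreal_toReal
  have hf0 : ∀ x, 0 ≤ f x := fun x => ENNReal.toReal_nonneg
  have hQ : Q = P.withDensity fun x => ENNReal.ofReal (f x) := by
    conv_lhs => rw [← Measure.withDensity_rnDeriv_eq _ _ hac]
    refine withDensity_congr_ae ?_
    filter_upwards [Q.rnDeriv_lt_top P] with x hx
    exact (ENNReal.ofReal_toReal hx.ne).symm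
  have hsmall : ∀ᶠ n : ℕ in atTop, ((n : ℝ) + 1) * (δ / 2) ≥ Real.log 2 :=
    ((tendsto_natCast_atTop_atTop.atTop_add tendsto_const_nhds).atTop_mul_const
      (half_pos hδ)).eventually_ge_atTop _
  have hquarter : (0 : ℝ≥0∞) < ENNReal.ofReal (1 / 4) := by simp
  filter_upwards [hlim.eventually_lt_const hquarter, hllr.eventually_lt_const hquarter, hsmall]
    with n h1 h2 h3
  set C := {x : Fin (n + 1) → α | δ / 2 ≤ |(∑ i, llr Q P (x i)) / ((n + 1 : ℕ) : ℝ) - D|} with hC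
  have hCm : MeasurableSet C := by
    have := measurable_llr Q P
    exact measurableSet_le measurable_const (by fun_prop)
  set πQ := Measure.pi fun _ : Fin (n + 1) => Q with hπQ
  set πP := Measure.pi fun _ : Fin (n + 1) => P with hπP
  have hN : (0 : ℝ) < ((n + 1 : ℕ) : ℝ) := by positivity
  have hhalf : 1 / 2 ≤ πQ.real (A n ∩ Cᶜ) := by
    have h4 : πQ.real (A n ∩ Cᶜ)ᶜ ≤ πQ.real (A n)ᶜ + πQ.real C := by
      rw [Set.compl_inter, compl_compl]
      exact measureReal_union_le _ _
    rw [probReal_compl_eq_one_sub ((hA n).inter hCm.compl)] at h4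
    have h5 : πQ.real (A n)ᶜ < 1 / 4 :=
      (ENNReal.lt_ofReal_iff_toReal_lt (measure_ne_top _ _)).1 h1
    have h6 : πQ.real C < 1 / 4 := (ENNReal.lt_ofReal_iff_toReal_lt (measure_ne_top _ _)).1 h2
    linarith
  have hdens : ∀ x ∈ A n ∩ Cᶜ, ∏ i, f (x i) ≤ Real.exp ((n + 1 : ℕ) * (D + δ / 2)) := by
    rintro x ⟨-, hx⟩
    by_cases h0 : ∀ i, 0 < f (x i)
    · have hx' : |(∑ i, llr Q P (x i)) / ((n + 1 : ℕ) : ℝ) - D| < δ / 2 := not_le.1 hx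
      have h7 : (∑ i, llr Q P (x i)) / ((n + 1 : ℕ) : ℝ) ≤ D + δ / 2 := by
        linarith [(abs_lt.1 hx').2]
      rw [div_le_iff₀ hN] at h7
      rw [← Real.log_le_iff_le_exp (Finset.prod_pos fun i _ => h0 i),
        Real.log_prod fun i _ => (h0 i).ne', mul_comm]
      exact h7
    · push Not at h0
      obtain ⟨i, hi⟩ := h0
      rw [Finset.prod_eq_zero (Finset.mem_univ i) (le_antisymm hi (hf0 _))]
      exact (Real.exp_pos _).le
  have hcomp : πQ.real (A n ∩ Cᶜ) ≤ Real.exp ((n + 1 : ℕ) * (D + δ / 2)) * πP.real (A n) := by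
    have h8 : πQ (A n ∩ Cᶜ) ≤ ENNReal.ofReal (Real.exp ((n + 1 : ℕ) * (D + δ / 2))) * πP (A n) := by
      rw [hπQ, pi_withDensity_ofReal hf0 Measure.integrable_toReal_rnDeriv hQ,
        withDensity_apply _ ((hA n).inter hCm.compl)]
      calc ∫⁻ x in A n ∩ Cᶜ, ENNReal.ofReal (∏ i, f (x i)) ∂πP
          ≤ ∫⁻ _ in A n ∩ Cᶜ, ENNReal.ofReal (Real.exp ((n + 1 : ℕ) * (D + δ / 2))) ∂πP :=
            setLIntegral_mono' ((hA n).inter hCm.compl) fun x hx =>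
              ENNReal.ofReal_le_ofReal (hdens x hx)
        _ ≤ _ := by
            rw [setLIntegral_const]
            gcongr
            exact Set.inter_subset_left
    have h9 := ENNReal.toReal_mono (ENNReal.mul_ne_top ENNReal.ofReal_ne_top
      (measure_ne_top _ _)) h8
    rwa [ENNReal.toReal_mul, ENNReal.toReal_ofReal (Real.exp_pos _).le] at h9
  have h10 : Real.exp (-((n + 1 : ℕ) * (D + δ))) * Real.exp ((n + 1 : ℕ) * (D + δ / 2)) ≤ 1 / 2 := by
    rw [← Real.exp_add, ← Real.le_log_iff_exp_le (by norm_num), one_div, Real.log_inv]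
    push_cast
    linarith
  have h11 : Real.exp (-((n + 1 : ℕ) * (D + δ))) * Real.exp ((n + 1 : ℕ) * (D + δ / 2))
      ≤ πP.real (A n) * Real.exp ((n + 1 : ℕ) * (D + δ / 2)) := by
    linarith
  exact le_of_mul_le_mul_right h11 (Real.exp_pos _)

end ProductMeasure

section CompleteConvexity

variable {X : Type*} [MeasurableSpace X]

/-- Complete convexity only needs to be tested in one universe: mixtures over standard Borel spaces
in any universe stay in `Γ`. -/
lemma CompletelyConvexP.mem_of_eq_bind {Γ : Set (ProbabilityMeasure X)}
    (hΓ : CompletelyConvexP.{u} Γ) {Z : Type*} [MeasurableSpace Z] [StandardBorelSpace Z]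
    (W : Measure Z) [IsProbabilityMeasure W] (κ : Kernel Z X) [IsMarkovKernel κ]
    (hκ : ∀ z, ∃ ν ∈ Γ, (ν : Measure X) = κ z) {ρ : ProbabilityMeasure X}
    (hρ : (ρ : Measure X) = W.bind κ) : ρ ∈ Γ := by
  have : Nonempty Z := nonempty_of_isProbabilityMeasure W
  set e : Z → ULift.{u} ℝ := fun z => ULift.up (embeddingReal Z z) with he
  have hem : MeasurableEmbedding e :=
    (MeasurableEquiv.ulift.symm.measurableEmbedding).comp (measurableEmbedding_embeddingReal Z)
  obtain ⟨h, hh, hhe⟩ := hem.exists_measurable_extend measurable_id fun _ => this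
  have hprob : IsProbabilityMeasure (W.map e) :=
    Measure.isProbabilityMeasure_map hem.measurable.aemeasurable
  refine hΓ (ULift.{u} ℝ) inferInstance (W.map e) hprob (κ.comap h hh) inferInstance
    (fun z => by simpa using hκ (h z)) ρ ?_
  rw [hρ]
  ext s hs
  rw [Measure.bind_apply hs κ.measurable.aemeasurable,
    Measure.bind_apply hs (Kernel.measurable _).aemeasurable,
    lintegral_map (Kernel.measurable_coe _ hs) hem.measurable]
  refine lintegral_congr fun z => ?_
  rw [Kernel.comap_apply, show h (e z) = z from congrFun hhe z]

/-- The mixture of `ν₁` and `ν₂` with weights `n / (n + 1)` and `1 / (n + 1)`. -/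
noncomputable def segmentMixture (n : ℕ) (ν₁ ν₂ : ProbabilityMeasure X) : ProbabilityMeasure X :=
  ⟨((n + 1 : ℕ) : ℝ≥0∞)⁻¹ • ((n : ℝ≥0∞) • (ν₁ : Measure X) + ν₂), by
    constructor
    have h : (n : ℝ≥0∞) + 1 = ((n + 1 : ℕ) : ℝ≥0∞) := by push_cast; rfl
    simp only [Measure.smul_apply, Measure.add_apply, measure_univ, smul_eq_mul, mul_one, h]
    exact ENNReal.inv_mul_cancel (by simp) (by simp)⟩

lemma coe_segmentMixture (n : ℕ) (ν₁ ν₂ : ProbabilityMeasure X) :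
    (segmentMixture n ν₁ ν₂ : Measure X)
      = ((n + 1 : ℕ) : ℝ≥0∞)⁻¹ • ((n : ℝ≥0∞) • (ν₁ : Measure X) + ν₂) := rfl

lemma CompletelyConvexP.segmentMixture_mem {Γ : Set (ProbabilityMeasure X)}
    (hΓ : CompletelyConvexP.{u} Γ) (n : ℕ) {ν₁ ν₂ : ProbabilityMeasure X} (h₁ : ν₁ ∈ Γ)
    (h₂ : ν₂ ∈ Γ) : segmentMixture n ν₁ ν₂ ∈ Γ := by
  let κ : Kernel Bool X :=
    ⟨fun b => if b then (ν₁ : Measure X) else ν₂, measurable_of_countable _⟩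
  have hκ : ∀ b, κ b = if b then (ν₁ : Measure X) else ν₂ := fun _ => rfl
  have hmk : IsMarkovKernel κ := ⟨fun b => by
    rw [hκ]
    cases b <;> simp <;> infer_instance⟩
  set W : Measure Bool :=
    ((n + 1 : ℕ) : ℝ≥0∞)⁻¹ • ((n : ℝ≥0∞) • Measure.dirac true + Measure.dirac false) with hW
  have hprob : IsProbabilityMeasure W := by
    constructor
    have h : (n : ℝ≥0∞) + 1 = ((n + 1 : ℕ) : ℝ≥0∞) := by push_cast; rfl
    simp only [hW, Measure.smul_apply, Measure.add_apply, measure_univ, smul_eq_mul, mul_one, h]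
    exact ENNReal.inv_mul_cancel (by simp) (by simp)
  refine hΓ.mem_of_eq_bind W κ (fun b => ?_) ?_
  · cases b
    · exact ⟨ν₂, h₂, by simp [hκ]⟩
    · exact ⟨ν₁, h₁, by simp [hκ]⟩
  · ext s hs
    rw [Measure.bind_apply hs κ.measurable.aemeasurable, coe_segmentMixture, hW]
    simp [lintegral_smul_measure, lintegral_add_measure, hκ]

variable [TopologicalSpace X] [OpensMeasurableSpace X]

lemma continuous_segmentMixture_left (n : ℕ) (ν : ProbabilityMeasure X) :
    Continuous fun μ => segmentMixture n μ ν := by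
  rw [ProbabilityMeasure.continuous_iff_forall_continuous_integral]
  intro f
  have hint : ∀ μ : ProbabilityMeasure X, Integrable f (μ : Measure X) := fun μ =>
    f.integrable _
  have heq : ∀ μ : ProbabilityMeasure X, ∫ x, f x ∂(segmentMixture n μ ν : Measure X)
      = ((n : ℝ) + 1)⁻¹ * (n * ∫ x, f x ∂(μ : Measure X) + ∫ x, f x ∂(ν : Measure X)) := by
    intro μ
    rw [coe_segmentMixture, integral_smul_measure,
      integral_add_measure ((hint μ).smul_measure (ENNReal.natCast_ne_top n)) (hint ν),
      integral_smul_measure]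
    simp only [ENNReal.toReal_inv, ENNReal.toReal_natCast, smul_eq_mul]
    push_cast
    rfl
  simp only [heq]
  have := ProbabilityMeasure.continuous_integral_boundedContinuousFunction (X := X) f
  fun_prop

end CompleteConvexity

section EmpiricalMeasure

variable {X : Type*} [MeasurableSpace X]

lemma coe_empDist {n : ℕ} (x : Fin (n + 1) → X) :
    (empDist x : Measure X) = ((n + 1 : ℕ) : ℝ≥0∞)⁻¹ • ∑ i, Measure.dirac (x i) := rfl

lemma empDist_comp_perm {n : ℕ} (x : Fin (n + 1) → X) (σ : Equiv.Perm (Fin (n + 1))) :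
    empDist (fun i => x (σ i)) = empDist x := by
  apply Subtype.ext
  change (empDist (fun i => x (σ i)) : Measure X) = empDist x
  rw [coe_empDist, coe_empDist, Equiv.sum_comp σ fun i => Measure.dirac (x i)]

lemma empDist_apply {n : ℕ} (x : Fin (n + 1) → X) {s : Set X} (hs : MeasurableSet s) :
    (empDist x : Measure X) s = ((n + 1 : ℕ) : ℝ≥0∞)⁻¹ * ∑ i, s.indicator 1 (x i) := by
  simp [coe_empDist, Measure.finsetSum_apply, Measure.dirac_apply' _ hs]

lemma integral_empDist {n : ℕ} (x : Fin (n + 1) → X) {f : X → ℝ} (hf : Measurable f) :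
    ∫ y, f y ∂(empDist x : Measure X) = (∑ i, f (x i)) / ((n + 1 : ℕ) : ℝ) := by
  rw [coe_empDist, integral_smul_measure, integral_finsetSum_measure fun i _ =>
    (integrable_dirac' hf.stronglyMeasurable (by simp))]
  simp only [integral_dirac' _ _ hf.stronglyMeasurable, ENNReal.toReal_inv,
    ENNReal.toReal_natCast, smul_eq_mul]
  rw [div_eq_inv_mul]

/-- The empirical measure as a Markov kernel. -/
noncomputable def empKernel (X : Type*) [MeasurableSpace X] (n : ℕ) : Kernel (Fin (n + 1) → X) X :=
  ⟨fun x => (empDist x : Measure X), by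
    refine Measure.measurable_of_measurable_coe _ fun s hs => ?_
    simp only [empDist_apply _ hs]
    refine (Finset.measurable_sum _ fun i _ => ?_).const_mul _
    exact (measurable_one.indicator hs).comp (measurable_pi_apply i)⟩

instance (n : ℕ) : IsMarkovKernel (empKernel X n) :=
  ⟨fun x => (empDist x).2⟩

/-- The law of a coordinate of an i.i.d. sample conditioned on its empirical measure being in `Γ`
does not depend on the coordinate. -/
lemma map_eval_cond_empDist_eq (P : Measure X) [IsProbabilityMeasure P]
    {Γ : Set (ProbabilityMeasure X)} {n : ℕ}
    (hA : MeasurableSet {x : Fin (n + 1) → X | empDist x ∈ Γ}) (i : Fin (n + 1)) :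
    Measure.map (fun x : Fin (n + 1) → X => x i)
        (ProbabilityTheory.cond (Measure.pi fun _ : Fin (n + 1) => P) {x | empDist x ∈ Γ})
      = Measure.map (fun x : Fin (n + 1) → X => x 0)
        (ProbabilityTheory.cond (Measure.pi fun _ : Fin (n + 1) => P) {x | empDist x ∈ Γ}) := by
  ext s hs
  rw [Measure.map_apply (measurable_pi_apply i) hs, Measure.map_apply (measurable_pi_apply 0) hs,
    ProbabilityTheory.cond_apply hA, ProbabilityTheory.cond_apply hA]
  congr 1
  rw [← (measurePreserving_pi_comp_perm P (Equiv.swap 0 i)).measure_preimage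
    (hA.inter (measurable_pi_apply i hs)).nullMeasurableSet]
  congr 1
  ext x
  simp [empDist_comp_perm]

variable [TopologicalSpace X] [BorelSpace X]

lemma continuous_empDist (n : ℕ) : Continuous (empDist : (Fin (n + 1) → X) → _) := by
  rw [ProbabilityMeasure.continuous_iff_forall_continuous_integral]
  intro f
  simp only [integral_empDist _ f.continuous.measurable]
  fun_prop

lemma measurableSet_empDist_mem [SecondCountableTopology X] {Γ : Set (ProbabilityMeasure X)}
    (hΓ : @MeasurableSet (ProbabilityMeasure X) (borel (ProbabilityMeasure X)) Γ) (n : ℕ) :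
    MeasurableSet {x : Fin (n + 1) → X | empDist x ∈ Γ} := by
  let _ : MeasurableSpace (ProbabilityMeasure X) := borel _
  have : BorelSpace (ProbabilityMeasure X) := ⟨rfl⟩
  exact (continuous_empDist n).measurable hΓ

/-- The empirical measures of an i.i.d. sample converge weakly in probability to the sampling
distribution. -/
lemma tendsto_pi_measure_empDist_notMem (ρ : ProbabilityMeasure X)
    {U : Set (ProbabilityMeasure X)} (hU : U ∈ 𝓝 ρ) :
    Tendsto (fun n : ℕ => (Measure.pi fun _ : Fin (n + 1) => (ρ : Measure X))
      {x | empDist x ∉ U}) atTop (𝓝 0) := by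
  let F : Filter (ProbabilityMeasure X) :=
    { sets := {V | Tendsto (fun n : ℕ => (Measure.pi fun _ : Fin (n + 1) => (ρ : Measure X))
        {x | empDist x ∉ V}) atTop (𝓝 0)}
      univ_sets := by simp
      sets_of_superset := fun {V V'} hV hVV' =>
        tendsto_of_tendsto_of_tendsto_of_le_of_le tendsto_const_nhds hV (fun _ => zero_le)
          fun n => measure_mono fun x hx hxV => hx (hVV' hxV)
      inter_sets := fun {V V'} hV hV' => by
        have h := Tendsto.add hV hV'
        rw [add_zero] at h
        refine tendsto_of_tendsto_of_tendsto_of_le_of_le tendsto_const_nhds h (fun _ => zero_le)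
          fun n => (measure_mono fun x hx => ?_).trans (measure_union_le _ _)
        exact not_and_or.1 hx }
  have hF : Tendsto id F (𝓝 ρ) := by
    rw [ProbabilityMeasure.tendsto_iff_forall_integral_tendsto]
    intro f
    rw [Metric.tendsto_nhds]
    intro ε hε
    have h := tendsto_pi_measure_average_sub_integral (Q := (ρ : Measure X)) f.continuous.measurable
      (f.integrable _) hε
    change Tendsto _ _ _
    refine h.congr fun n => congrArg _ ?_
    ext x
    simp [Real.dist_eq, integral_empDist x f.continuous.measurable]
  exact hF hU

/-- The law of the first coordinate of an i.i.d. sample conditioned on its empirical measure being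
in a completely convex set `Γ` belongs to `Γ`. -/
lemma CompletelyConvexP.map_cond_empDist_mem [PolishSpace X] {Γ : Set (ProbabilityMeasure X)}
    (hΓ : CompletelyConvexP.{u} Γ) (P : Measure X) [IsProbabilityMeasure P] {n : ℕ}
    (hA : MeasurableSet {x : Fin (n + 1) → X | empDist x ∈ Γ})
    (hA0 : (Measure.pi fun _ : Fin (n + 1) => P) {x | empDist x ∈ Γ} ≠ 0)
    {ρ : ProbabilityMeasure X}
    (hρ : (ρ : Measure X) = Measure.map (fun x : Fin (n + 1) → X => x 0)
      (ProbabilityTheory.cond (Measure.pi fun _ : Fin (n + 1) => P) {x | empDist x ∈ Γ})) :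
    ρ ∈ Γ := by
  set A := {x : Fin (n + 1) → X | empDist x ∈ Γ} with hAdef
  set W := ProbabilityTheory.cond (Measure.pi fun _ : Fin (n + 1) => P) A with hW
  have hWprob : IsProbabilityMeasure W := ProbabilityTheory.cond_isProbabilityMeasure hA0
  obtain ⟨x₀, hx₀⟩ : A.Nonempty := nonempty_of_measure_ne_zero hA0
  let k : (Fin (n + 1) → X) → (Fin (n + 1) → X) := fun x => if x ∈ A then x else x₀
  have hk : Measurable k := Measurable.ite hA measurable_id measurable_const
  have hkA : ∀ x, k x ∈ A := fun x => by
    by_cases hx : x ∈ A <;> simp [k, hx, hx₀]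
  refine hΓ.mem_of_eq_bind W ((empKernel X n).comap k hk) (fun x => ⟨empDist (k x), hkA x, rfl⟩) ?_
  ext s hs
  rw [Measure.bind_apply hs (Kernel.measurable _).aemeasurable]
  have hae : ∀ᵐ x ∂W, ((empKernel X n).comap k hk) x s
      = ((n + 1 : ℕ) : ℝ≥0∞)⁻¹ * ∑ i, s.indicator 1 (x i) := by
    filter_upwards [ProbabilityTheory.ae_cond_mem hA] with x hx
    rw [Kernel.comap_apply, show k x = x from if_pos hx]
    exact empDist_apply x hs
  have hev : ∀ i, Measurable fun x : Fin (n + 1) → X => x i := measurable_pi_apply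
  have hind : Measurable (s.indicator (1 : X → ℝ≥0∞)) := measurable_one.indicator hs
  have hterm_meas : ∀ i, Measurable fun x : Fin (n + 1) → X => s.indicator (1 : X → ℝ≥0∞) (x i) :=
    fun i => hind.comp (hev i)
  rw [lintegral_congr_ae hae,
    lintegral_const_mul _ (Finset.measurable_sum _ fun i _ => hterm_meas i),
    lintegral_finsetSum _ fun i _ => hterm_meas i]
  have hterm : ∀ i, ∫⁻ x, s.indicator (1 : X → ℝ≥0∞) (x i) ∂W = (ρ : Measure X) s := by
    intro i
    rw [← lintegral_map hind (hev i), map_eval_cond_empDist_eq P hA i, ← hρ,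
      lintegral_indicator_one hs]
  simp only [hterm, Finset.sum_const, Finset.card_univ, Fintype.card_fin, nsmul_eq_mul]
  rw [← mul_assoc, ENNReal.inv_mul_cancel (by simp) (by simp), one_mul]

end EmpiricalMeasure

/-- **Gibbs conditioning principle.** Let `Γ` be a completely convex Borel set of probability
measures with `D(Γ°‖P) = D(cl Γ‖P)`, attained uniquely by `Q*` on `cl Γ`. Then the
conditional laws `Q_n(B) = ℙ{X₁ ∈ B | L_{X^n} ∈ Γ}` converge to `Q*` in relative entropy,
and in particular weakly. -/
theorem gibbs_conditioning {X : Type*} [MeasurableSpace X] [TopologicalSpace X]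
    [PolishSpace X] [BorelSpace X] (P : Measure X) [IsProbabilityMeasure P]
    (Γ : Set (ProbabilityMeasure X))
    (hBorel : @MeasurableSet (ProbabilityMeasure X) (borel (ProbabilityMeasure X)) Γ)
    (hcconv : CompletelyConvexP.{u} Γ)
    (hI : (⨅ R ∈ interior Γ, relEnt (R : Measure X) P)
        = ⨅ R ∈ closure Γ, relEnt (R : Measure X) P)
    (hpos : ∀ᶠ n : ℕ in atTop,
      0 < (Measure.pi fun _ : Fin (n + 1) => P) {x | empDist x ∈ Γ})
    (Qstar : ProbabilityMeasure X) (hQcl : Qstar ∈ closure Γ)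
    (hQmin : relEnt (Qstar : Measure X) P = ⨅ R ∈ closure Γ, relEnt (R : Measure X) P)
    (hQuniq : ∀ R ∈ closure Γ,
      relEnt (R : Measure X) P = (⨅ S ∈ closure Γ, relEnt (S : Measure X) P) → R = Qstar)
    (Qn : ℕ → Measure X)
    (hQn : ∀ n : ℕ, Qn n = Measure.map (fun x : Fin (n + 1) → X => x 0)
      (ProbabilityTheory.cond (Measure.pi fun _ : Fin (n + 1) => P)
        {x | empDist x ∈ Γ})) :
    Tendsto (fun n : ℕ => relEnt (Qn n) (Qstar : Measure X)) atTop (𝓝 0)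
    ∧ ∀ f : BoundedContinuousFunction X ℝ,
        Tendsto (fun n : ℕ => ∫ x, f x ∂(Qn n)) atTop
          (𝓝 (∫ x, f x ∂(Qstar : Measure X))) := by
  have hA := measurableSet_empDist_mem hBorel
  have hcond : ∀ᶠ n : ℕ in atTop, ∃ ρ : ProbabilityMeasure X, (ρ : Measure X) = Qn n ∧ ρ ∈ Γ ∧
      klDiv (ρ : Measure X) P ≠ ∞ ∧ (n + 1 : ℕ) * (klDiv (ρ : Measure X) P).toReal
        ≤ -Real.log ((Measure.pi fun _ : Fin (n + 1) => P).real {x | empDist x ∈ Γ}) := by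
    filter_upwards [hpos] with n hn
    have hcp := ProbabilityTheory.cond_isProbabilityMeasure hn.ne'
    have hprob : IsProbabilityMeasure (Qn n) := by
      rw [hQn]
      exact Measure.isProbabilityMeasure_map (measurable_pi_apply 0).aemeasurable
    obtain ⟨ρ, hρ⟩ : ∃ ρ : ProbabilityMeasure X, (ρ : Measure X) = Qn n := ⟨⟨Qn n, hprob⟩, rfl⟩
    have hρQ := hρ.trans (hQn n)
    exact ⟨ρ, hρ, hcconv.map_cond_empDist_mem P (hA n) hn.ne' hρQ,
      klDiv_map_cond_pi_le hn.ne'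
        (fun i => (map_eval_cond_empDist_eq P (hA n) i).trans hρQ.symm) n.succ_ne_zero⟩
  have hmin : ∀ ρ ∈ closure Γ, klDiv (Qstar : Measure X) P ≤ klDiv (ρ : Measure X) P := by
    intro ρ hρ
    rw [← relEnt_eq_klDiv, ← relEnt_eq_klDiv, hQmin]
    exact iInf₂_le ρ hρ
  have hstar : klDiv (Qstar : Measure X) P ≠ ∞ := by
    obtain ⟨n, ρ, -, hρ, hfin, -⟩ := hcond.exists
    exact ne_top_of_le_ne_top hfin (hmin ρ (subset_closure hρ))
  have hmain : Tendsto (fun n : ℕ => relEnt (Qn n) (Qstar : Measure X)) atTop (𝓝 0) := by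
    rw [ENNReal.tendsto_nhds_zero]
    intro ε hε
    obtain ⟨δ, hδ, hδε⟩ : ∃ δ : ℝ≥0, 0 < δ ∧ (δ : ℝ≥0∞) + δ ≤ ε := by
      obtain ⟨δ, hδ, hδε⟩ := ENNReal.lt_iff_exists_nnreal_btwn.1 hε
      refine ⟨δ / 2, half_pos (by simpa using hδ), ?_⟩
      rw [← ENNReal.coe_add, add_halves]
      exact hδε.le
    obtain ⟨ρ, hρ, hρlt⟩ : ∃ ρ ∈ interior Γ,
        klDiv (ρ : Measure X) P < klDiv (Qstar : Measure X) P + δ := by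
      have h : (⨅ R ∈ interior Γ, relEnt (R : Measure X) P)
          < klDiv (Qstar : Measure X) P + δ := by
        rw [hI, ← hQmin, relEnt_eq_klDiv]
        exact ENNReal.lt_add_right hstar (by simpa using hδ.ne')
      simpa only [iInf_lt_iff, exists_prop, relEnt_eq_klDiv] using h
    have hρfin : klDiv (ρ : Measure X) P ≠ ∞ := hρlt.ne_top
    filter_upwards [hcond, eventually_exp_le_pi_measureReal hρfin hA
      (tendsto_pi_measure_empDist_notMem ρ (mem_interior_iff_mem_nhds.1 hρ))
      (NNReal.coe_pos.2 hδ)] with n ⟨ν, hν, hνΓ, hνfin, hνle⟩ hexp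
    have hn : (0 : ℝ) < (n + 1 : ℕ) := by positivity
    have hlog := Real.log_le_log (Real.exp_pos _) hexp
    rw [Real.log_exp] at hlog
    have hreal : (klDiv (ν : Measure X) P).toReal ≤ (klDiv (ρ : Measure X) P).toReal + δ :=
      le_of_mul_le_mul_left (by linarith) hn
    have hνρ : klDiv (ν : Measure X) P ≤ klDiv (ρ : Measure X) P + δ := by
      rw [← ENNReal.toReal_le_toReal hνfin (by finiteness),
        ENNReal.toReal_add hρfin ENNReal.coe_ne_top]
      exact hreal
    have hpyth : klDiv (ν : Measure X) Qstar + klDiv (Qstar : Measure X) P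
        ≤ klDiv (ν : Measure X) P :=
      klDiv_add_klDiv_le hνfin hstar fun k =>
        hmin (segmentMixture k Qstar ν) <|
          map_mem_closure (f := fun μ => segmentMixture k μ ν)
            (continuous_segmentMixture_left k ν) hQcl fun _ hμ => hcconv.segmentMixture_mem k hμ hνΓ
    rw [← hν, relEnt_eq_klDiv]
    refine le_trans ?_ hδε
    refine (ENNReal.add_le_add_iff_right hstar).1 (hpyth.trans (hνρ.trans ?_))
    calc klDiv (ρ : Measure X) P + δ ≤ klDiv (Qstar : Measure X) P + δ + δ := by gcongr
      _ = δ + δ + klDiv (Qstar : Measure X) P := by ring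
  refine ⟨hmain, fun f => ?_⟩
  have hprob : ∀ᶠ n in atTop, IsProbabilityMeasure (Qn n) := by
    filter_upwards [hcond] with n ⟨ρ, hρ, _⟩
    rw [← hρ]
    infer_instance
  refine tendsto_integral_of_tendsto_klDiv hprob (hmain.congr' ?_) f.continuous.measurable
    f.norm_coe_le_norm
  filter_upwards [hprob] with n hn
  exact relEnt_eq_klDiv _ _
end
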